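/- arXiv:1909.02610 — 2 statements merged into one kernel-verified Lean document; each statement's English description precedes it below -/
import Mathlib

section
/- Let n ≥ 3 and m ≥ 1. If m ≡ 1 or 2 (mod 3), then depth(S_{n,m}/I(C_{n,m})) ≤ ⌈(n−1)/3⌉ + (⌈m/3⌉ − 1)·⌈n/3⌉; if m ≡ 0 (mod 3), then depth(S_{n,m}/I(C_{n,m})) ≤ ⌈n/3⌉·⌈m/3⌉. -/
open MvPolynomial

section Defs

variable (K : Type) [Field K] (σ : Type)
variable (M : Type) [AddCommGroup M] [Module K M] [Module (MvPolynomial σ K) M]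
  [IsScalarTower K (MvPolynomial σ K) M]

/-- The Stanley space `w K[A]`: the `K`-span of `{u • w : u a monomial in the variables of A}`. -/
noncomputable def stanleySpace (w : M) (A : Finset σ) : Submodule K M :=
  Submodule.span K { m | ∃ u : σ →₀ ℕ, (↑u.support : Set σ) ⊆ ↑A ∧
    m = (monomial u (1 : K) : MvPolynomial σ K) • w }

/-- `(w, A)` indexed by `Fin r` gives a Stanley decomposition of `M`:
each Stanley space `wᵢ K[Aᵢ]` is a free `K[Aᵢ]`-module and `M` is their internal direct
sum as a `K`-vector space. -/
def IsStanleyDecomp {r : ℕ} (w : Fin r → M) (A : Fin r → Finset σ) : Prop :=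
  (∀ i (f : MvPolynomial σ K), (↑f.vars : Set σ) ⊆ ↑(A i) → f • w i = 0 → f = 0) ∧
  (iSupIndep fun i => stanleySpace K σ M (w i) (A i)) ∧
  (⨆ i, stanleySpace K σ M (w i) (A i)) = ⊤

/-- The Stanley depth of `M`: the largest value of `minᵢ |Aᵢ|` over all Stanley
decompositions of `M`. -/
noncomputable def sdepth : ℕ :=
  sSup { d | ∃ r, ∃ w : Fin r → M, ∃ A : Fin r → Finset σ,
    IsStanleyDecomp K σ M w A ∧ d = sInf (Set.range fun i => (A i).card) }

/-- The depth of `M` with respect to the maximal graded ideal `(x₁, …, x_N)`: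
the maximal length of an `M`-regular sequence of elements of that ideal. -/
noncomputable def rdepth : ℕ :=
  sSup { d | ∃ rs : List (MvPolynomial σ K), rs.length = d ∧
    (∀ f ∈ rs, f ∈ Ideal.span (Set.range (X : σ → MvPolynomial σ K))) ∧
    RingTheory.Sequence.IsRegular M rs }

end Defs

/-- Adjacency in the strong product `Pₙ ⊠ Pₘ` (vertices `(i,j)`, `0`-indexed): distinct
vertices are adjacent iff both coordinates differ by at most `1`. -/
def pAdj (n m : ℕ) (a b : Fin n × Fin m) : Prop :=
  a ≠ b ∧ |((a.1 : ℤ) - (b.1 : ℤ))| ≤ 1 ∧ |((a.2 : ℤ) - (b.2 : ℤ))| ≤ 1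

/-- Adjacency in the strong product `Cₙ ⊠ Pₘ` (vertices `(i,j)`, `0`-indexed). -/
def cAdj (n m : ℕ) (a b : Fin n × Fin m) : Prop :=
  a ≠ b ∧ min ((a.1 : ℤ) - (b.1 : ℤ)).natAbs (n - ((a.1 : ℤ) - (b.1 : ℤ)).natAbs) ≤ 1 ∧
    |((a.2 : ℤ) - (b.2 : ℤ))| ≤ 1

/-- The edge ideal of the graph with vertex set `V` and adjacency relation `Adj`. -/
noncomputable def edgeIdeal (K : Type) [Field K] {V : Type} (Adj : V → V → Prop) :
    Ideal (MvPolynomial V K) :=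
  Ideal.span { p | ∃ a b : V, Adj a b ∧ p = X a * X b }

open scoped Pointwise

section Koszul
set_option linter.unusedSectionVars false
variable {R : Type} [CommRing R] {ι : Type} [DecidableEq ι]

/-- Koszul sign. -/
def kSg (R : Type) [CommRing R] (ρ : ι → ℕ) (t : ι) (T : Finset ι) : R :=
  (-1) ^ (T.filter (fun s => ρ s < ρ t)).card

/-- Koszul differential. -/
def kD {M : Type} [AddCommGroup M] [Module R M] (ρ : ι → ℕ) (y : ι → R)
    (f : Finset ι → M) (T : Finset ι) : M :=
  ∑ t ∈ T, (kSg R ρ t T * y t) • f (T.erase t)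

/-- Koszul contraction. -/
def kH (R : Type) [CommRing R] {M : Type} [AddCommGroup M] [Module R M] (ρ : ι → ℕ) (t : ι)
    (f : Finset ι → M) (T : Finset ι) : M :=
  if t ∈ T then 0 else kSg R ρ t T • f (insert t T)

lemma kSg_mul_self (ρ : ι → ℕ) (t : ι) (T : Finset ι) : kSg R ρ t T * kSg R ρ t T = 1 := by
  unfold kSg; rw [← mul_pow]; simp

lemma kSg_erase_self (ρ : ι → ℕ) (t : ι) (T : Finset ι) :
    kSg R ρ t (T.erase t) = kSg R ρ t T := by
  unfold kSg
  congr 2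
  ext s; simp only [Finset.mem_filter, Finset.mem_erase]
  constructor
  · rintro ⟨⟨_, h⟩, h'⟩; exact ⟨h, h'⟩
  · rintro ⟨h, h'⟩; exact ⟨⟨by rintro rfl; omega, h⟩, h'⟩

lemma kSg_insert_of_not_lt (ρ : ι → ℕ) (s t : ι) (T : Finset ι) (h : ¬ ρ t < ρ s) :
    kSg R ρ s (insert t T) = kSg R ρ s T := by
  unfold kSg; rw [Finset.filter_insert, if_neg h]

lemma kSg_insert_of_lt (ρ : ι → ℕ) (s t : ι) (T : Finset ι) (hT : t ∉ T) (h : ρ t < ρ s) :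
    kSg R ρ s (insert t T) = - kSg R ρ s T := by
  unfold kSg; rw [Finset.filter_insert, if_pos h, Finset.card_insert_of_notMem (by simp [hT])]
  ring

lemma kSg_swap (ρ : ι → ℕ) (hρ : Function.Injective ρ) (s t : ι) (T : Finset ι)
    (hs : s ∈ T) (ht : t ∉ T) :
    kSg R ρ s T * kSg R ρ t (T.erase s) = - (kSg R ρ t T * kSg R ρ s (insert t T)) := by
  have hst : ρ s ≠ ρ t := fun h => ht (hρ h ▸ hs)
  have e : insert s (T.erase s) = T := Finset.insert_erase hs
  rcases lt_or_gt_of_ne hst with h | h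
  · have h1 : kSg R ρ t T = - kSg R ρ t (T.erase s) := by
      conv_lhs => rw [← e]
      exact kSg_insert_of_lt ρ t s _ (by simp) h
    rw [kSg_insert_of_not_lt ρ s t T (by omega), h1]; ring
  · have h1 : kSg R ρ t T = kSg R ρ t (T.erase s) := by
      conv_lhs => rw [← e]
      exact kSg_insert_of_not_lt ρ t s _ (by omega)
    rw [kSg_insert_of_lt ρ s t T ht h, h1]; ring

variable {M : Type} [AddCommGroup M] [Module R M]

lemma kD_kH (ρ : ι → ℕ) (hρ : Function.Injective ρ) (y : ι → R) (t : ι) (f : Finset ι → M)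
    (T : Finset ι) :
    kD ρ y (kH R ρ t f) T + kH R ρ t (kD ρ y f) T = y t • f T := by
  by_cases ht : t ∈ T
  · rw [show kH R ρ t (kD ρ y f) T = 0 by simp [kH, ht], add_zero, kD,
      Finset.sum_eq_single_of_mem t ht]
    · simp only [kH, Finset.notMem_erase, if_false, smul_smul, Finset.insert_erase ht]
      rw [kSg_erase_self]
      rw [mul_right_comm, kSg_mul_self, one_mul]
    · intro s hs hst
      rw [kH, if_pos (by simp [ht, hst.symm]), smul_zero]
  · have h1 : kH R ρ t (kD ρ y f) T = y t • f T + ∑ s ∈ T,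
        (kSg R ρ t T * (kSg R ρ s (insert t T) * y s)) • f ((insert t T).erase s) := by
      rw [kH, if_neg ht, kD, Finset.sum_insert ht, smul_add, Finset.smul_sum]
      congr 1
      · rw [smul_smul, Finset.erase_insert ht, kSg_insert_of_not_lt ρ t t T (by omega),
          ← mul_assoc, kSg_mul_self, one_mul]
      · simp only [smul_smul]
    rw [h1, kD, add_left_comm, ← Finset.sum_add_distrib, Finset.sum_eq_zero, add_zero]
    intro s hs
    have hst : s ≠ t := by rintro rfl; exact ht hs
    rw [kH, if_neg (by simp [ht]), smul_smul, Finset.erase_insert_of_ne hst.symm, ← add_smul]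
    have := kSg_swap (R := R) ρ hρ s t T hs ht
    rw [show kSg R ρ s T * y s * kSg R ρ t (T.erase s) +
      kSg R ρ t T * (kSg R ρ s (insert t T) * y s) =
      (kSg R ρ s T * kSg R ρ t (T.erase s) + kSg R ρ t T * kSg R ρ s (insert t T)) * y s by ring,
      this]
    simp

lemma kD_add (ρ : ι → ℕ) (y : ι → R) (f g : Finset ι → M) :
    kD ρ y (f + g) = kD ρ y f + kD ρ y g := by
  ext T; simp [kD, smul_add, Finset.sum_add_distrib]

lemma kD_smul (ρ : ι → ℕ) (y : ι → R) (r : R) (f : Finset ι → M) :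
    kD ρ y (r • f) = r • kD ρ y f := by
  ext T; simp only [kD, Pi.smul_apply, Finset.smul_sum, smul_smul, mul_comm]

lemma kD_sum {α : Type} (ρ : ι → ℕ) (y : ι → R) (s : Finset α) (f : α → Finset ι → M) :
    kD ρ y (∑ a ∈ s, f a) = ∑ a ∈ s, kD ρ y (f a) := by
  ext T; simp only [kD, Finset.sum_apply, Finset.smul_sum]
  rw [Finset.sum_comm]

lemma kD_kD (ρ : ι → ℕ) (hρ : Function.Injective ρ) (y : ι → R) (T : Finset ι) :
    ∀ (f : Finset ι → M), kD ρ y (kD ρ y f) T = 0 := by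
  induction T using Finset.induction_on with
  | empty => intro f; simp [kD]
  | insert t T ht ih =>
    intro f
    have h1 : kD ρ y (kH R ρ t f) + kH R ρ t (kD ρ y f) = y t • f :=
      funext fun T => kD_kH ρ hρ y t f T
    have h2 := kD_kH ρ hρ y t (kD ρ y f) T
    have h3 := congrFun (congrArg (kD ρ y) h1) T
    rw [kD_add, kD_smul, Pi.add_apply, ih, zero_add, Pi.smul_apply] at h3
    rw [h3] at h2
    have h4 : kH R ρ t (kD ρ y (kD ρ y f)) T = 0 := by simpa using h2
    rw [kH, if_neg ht] at h4
    have h5 := congrArg (fun m => kSg R ρ t T • m) h4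
    simpa [smul_smul, kSg_mul_self] using h5

lemma kD_map {N : Type} [AddCommGroup N] [Module R N] (φ : M →ₗ[R] N) (ρ : ι → ℕ) (y : ι → R)
    (f : Finset ι → M) (T : Finset ι) :
    φ (kD ρ y f T) = kD ρ y (fun T => φ (f T)) T := by
  simp [kD]

lemma kD_support (ρ : ι → ℕ) (y : ι → R) (f : Finset ι → M) (i : ℕ)
    (hf : ∀ T, T.card ≠ i → f T = 0) (T : Finset ι) (hT : T.card ≠ i + 1) : kD ρ y f T = 0 := by
  refine Finset.sum_eq_zero fun t ht => ?_
  rw [hf, smul_zero]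
  have := Finset.card_erase_add_one ht
  omega

theorem koszul_vanish [Fintype ι] (ρ : ι → ℕ) (hρ : Function.Injective ρ) (y : ι → R)
    (rs : List R) : ∀ (M : Type) [AddCommGroup M] [Module R M],
    (∀ r ∈ rs, ∃ s : ℕ, ∃ a : ι → R, ∀ m : M, r ^ s • m = (∑ t, a t * y t) • m) →
    RingTheory.Sequence.IsWeaklyRegular M rs →
    ∀ (i : ℕ), i < rs.length → ∀ f : Finset ι → M, (∀ T, T.card ≠ i → f T = 0) →
    kD ρ y f = 0 → ∃ g : Finset ι → M, (∀ T, T.card + 1 ≠ i → g T = 0) ∧ kD ρ y g = f := by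
  induction rs with
  | nil => intro M _ _ _ _ i hi; simp at hi
  | cons r rs ih =>
    intro M _ _ hr hreg i hi f hf hdf
    rw [RingTheory.Sequence.isWeaklyRegular_cons_iff] at hreg
    obtain ⟨hr0, hregQ⟩ := hreg
    have hrQ : ∀ r' ∈ rs, ∃ s : ℕ, ∃ a : ι → R, ∀ m : QuotSMulTop r M,
        r' ^ s • m = (∑ t, a t * y t) • m := by
      intro r' hr'
      obtain ⟨s, a, h⟩ := hr r' (by simp [hr'])
      refine ⟨s, a, fun m => ?_⟩
      obtain ⟨m, rfl⟩ := Submodule.mkQ_surjective _ m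
      rw [← map_smul, h, map_smul]
    have key : ∀ s : ℕ, ∀ h : Finset ι → M, (∀ T, T.card + 1 ≠ i → h T = 0) →
        kD ρ y h = r ^ s • f → ∃ g : Finset ι → M, (∀ T, T.card + 1 ≠ i → g T = 0) ∧
          kD ρ y g = f := by
      intro s
      induction s with
      | zero => intro h h1 h2; exact ⟨h, h1, by simpa using h2⟩
      | succ s ihs =>
        intro h h1 h2
        have : ∃ g : Finset ι → M, (∀ T, T.card + 1 + 1 ≠ i → g T = 0) ∧
            ∀ T, ∃ m : M, h T = kD ρ y g T + r • m := by
          rcases i with _ | i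
          · refine ⟨0, fun _ _ => rfl, fun T => ⟨0, ?_⟩⟩
            rw [h1 T (by omega)]; simp [kD]
          · let q := (r • (⊤ : Submodule R M)).mkQ
            obtain ⟨g, hg, hdg⟩ := ih (QuotSMulTop r M) hrQ hregQ i
              (by simpa using hi) (fun T => q (h T))
              (fun T hT => by rw [h1 T (by omega), map_zero]) (by
                ext T
                rw [← kD_map q, h2]
                rw [Pi.smul_apply, Pi.zero_apply, pow_succ', mul_smul]
                exact (Submodule.Quotient.mk_eq_zero _).2
                  (Submodule.smul_mem_pointwise_smul _ _ _ trivial))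
            choose g' hg' using fun T => Submodule.mkQ_surjective (r • (⊤ : Submodule R M)) (g T)
            refine ⟨fun T => if T.card + 1 = i then g' T else 0, fun T hT => ?_, fun T => ?_⟩
            · exact if_neg (by omega)
            · have : q (h T - kD ρ y (fun T => if T.card + 1 = i then g' T else 0) T) = 0 := by
                rw [map_sub, kD_map q, sub_eq_zero]
                have := congrFun hdg T
                rw [← this]
                congr 1
                ext T
                by_cases hc : T.card + 1 = i
                · simp only [hc, if_true]; exact (hg' T).symm
                · simp only [hc, if_false, map_zero]; exact hg T hc
              have := (Submodule.Quotient.mk_eq_zero _).1 this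
              obtain ⟨m, -, hm⟩ := (Submodule.mem_smul_pointwise_iff_exists _ _ _).1 this
              exact ⟨m, by rw [hm]; abel⟩
        obtain ⟨g, hg, hh⟩ := this
        choose h' hh' using hh
        have e : h = kD ρ y g + r • h' := funext hh'
        refine ihs h' (fun T hT => ?_) ?_
        · have h3 := hh' T
          rw [h1 T hT] at h3
          have : kD ρ y g T = 0 := by
            refine Finset.sum_eq_zero fun t ht => ?_
            rw [hg, smul_zero]
            have := Finset.card_erase_add_one ht
            omega
          rw [this, zero_add] at h3
          exact hr0 (by simpa using h3.symm)
        · have h4 : r • kD ρ y h' = r • (r ^ s • f) := by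
            rw [smul_smul, ← pow_succ', ← h2, e, kD_add, kD_smul]
            rw [show kD ρ y (kD ρ y g) = 0 from funext fun T => kD_kD ρ hρ y T g, zero_add]
          ext T
          exact hr0 (congrFun h4 T)
    obtain ⟨s, a, hs⟩ := hr r (by simp)
    refine key s (∑ t, a t • kH R ρ t f) (fun T hT => ?_) ?_
    · rw [Finset.sum_apply]
      refine Finset.sum_eq_zero fun t _ => ?_
      rw [Pi.smul_apply, kH]
      split_ifs with h
      · simp
      · rw [hf, smul_zero, smul_zero]
        rw [Finset.card_insert_of_notMem h]; exact hT
    · rw [kD_sum]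
      ext T
      rw [Finset.sum_apply, Pi.smul_apply, hs, Finset.sum_smul]
      refine Finset.sum_congr rfl fun t _ => ?_
      rw [kD_smul, Pi.smul_apply, mul_smul, ← kD_kH ρ hρ y t f T, hdf]
      simp [kH]

end Koszul

section Abstract
set_option linter.unusedSectionVars false
variable {K : Type} [Field K] {V : Type} [DecidableEq V]

/-- Indicator exponent. -/
noncomputable def eInd (T : Finset V) : V →₀ ℕ := ∑ v ∈ T, Finsupp.single v 1

lemma eInd_apply (T : Finset V) (v : V) : eInd T v = if v ∈ T then 1 else 0 := by
  simp [eInd, Finsupp.finsetSum_apply, Finsupp.single_apply]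

lemma eInd_sub (T : Finset V) (t : V) : eInd T - Finsupp.single t 1 = eInd (T.erase t) := by
  ext v
  rw [Finsupp.tsub_apply, eInd_apply, eInd_apply, Finsupp.single_apply]
  by_cases h : t = v
  · subst h; simp; split_ifs <;> rfl
  · have h' : v ≠ t := fun e => h e.symm
    simp [h, h']

lemma coeff_edgeIdeal (Adj : V → V → Prop) (T : Finset V)
    (hT : ∀ v ∈ T, ∀ w ∈ T, ¬ Adj v w)
    (p : MvPolynomial V K) (hp : p ∈ edgeIdeal K Adj) : coeff (eInd T) p = 0 := by
  have e : { p : MvPolynomial V K | ∃ a b : V, Adj a b ∧ p = X a * X b } =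
      (fun s => monomial s (1 : K)) ''
        {s | ∃ a b, Adj a b ∧ s = Finsupp.single a 1 + Finsupp.single b 1} := by
    ext p
    constructor
    · rintro ⟨a, b, h, rfl⟩
      exact ⟨_, ⟨a, b, h, rfl⟩, by simp [X, monomial_mul]⟩
    · rintro ⟨_, ⟨a, b, h, rfl⟩, rfl⟩
      exact ⟨a, b, h, by simp [X, monomial_mul]⟩
  rw [edgeIdeal, e, mem_ideal_span_monomial_image] at hp
  by_contra hc
  obtain ⟨_, ⟨a, b, hab, rfl⟩, hle⟩ := hp (eInd T) (by simpa [mem_support_iff] using hc)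
  have ha := hle a
  have hb := hle b
  rw [Finsupp.add_apply, eInd_apply] at ha hb
  simp only [Finsupp.single_eq_same] at ha hb
  refine hT a ?_ b ?_ hab
  · by_contra h; simp [h] at ha
  · by_contra h; simp [h] at hb

/-- Sum of the variables in `P v`. -/
noncomputable def lF (K : Type) [Field K] (P : V → Finset V) (v : V) : MvPolynomial V K :=
  ∑ w ∈ P v, X w

lemma coeff_X_mul_not (T : Finset V) (w : V) (hw : w ∉ T) (h : MvPolynomial V K) :
    coeff (eInd T) (X w * h) = 0 := by
  rw [coeff_X_mul', if_neg]
  simp [eInd_apply, hw]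

lemma coeff_X_mul_mem (T : Finset V) (w : V) (hw : w ∈ T) (h : MvPolynomial V K) :
    coeff (eInd T) (X w * h) = coeff (eInd (T.erase w)) h := by
  rw [coeff_X_mul', if_pos, eInd_sub]
  simp [eInd_apply, hw]

lemma coeff_lF_mul (P : V → Finset V) (T : Finset V) (t : V) (ht : t ∈ T) (h1 : t ∈ P t)
    (h2 : ∀ w ∈ P t, w ≠ t → w ∉ T) (h : MvPolynomial V K) :
    coeff (eInd T) (lF K P t * h) = coeff (eInd (T.erase t)) h := by
  rw [lF, Finset.sum_mul, coeff_sum, Finset.sum_eq_single_of_mem t h1, coeff_X_mul_mem T t ht]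
  intro w hw hwt
  exact coeff_X_mul_not T w (h2 w hw hwt) h

lemma coeff_sq_mul (T : Finset V) (t : V) (h : MvPolynomial V K) :
    coeff (eInd T) (X t ^ 2 * h) = 0 := by
  rw [pow_two, mul_assoc]
  by_cases ht : t ∈ T
  · rw [coeff_X_mul_mem T t ht, coeff_X_mul_not _ _ (by simp)]
  · rw [coeff_X_mul_not _ _ ht]

lemma coeff_prod_lF (P : V → Finset V) (T : Finset V)
    (h : ∀ t ∈ T, t ∈ P t ∧ ∀ w ∈ P t, w ≠ t → w ∉ T) :
    coeff (eInd T) (∏ t ∈ T, lF K P t) = 1 := by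
  induction T using Finset.induction_on with
  | empty => simp [eInd]
  | insert t T ht ih =>
    rw [Finset.prod_insert ht, coeff_lF_mul P _ t (by simp) (h t (by simp)).1 (h t (by simp)).2,
      Finset.erase_insert ht]
    refine ih fun s hs => ⟨(h s (by simp [hs])).1, fun w hw hws => ?_⟩
    have := (h s (by simp [hs])).2 w hw hws
    simp only [Finset.mem_insert, not_or] at this
    exact this.2

lemma lF_mul_prod_mem (Adj : V → V → Prop) (P : V → Finset V) (G : Finset V) (t : V)
    (h : ∀ w ∈ P t, ∃ v ∈ G, ∀ w' ∈ P v, Adj w w') :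
    lF K P t * ∏ v ∈ G, lF K P v ∈ edgeIdeal K Adj := by
  rw [lF, Finset.sum_mul]
  refine Ideal.sum_mem _ fun w hw => ?_
  obtain ⟨v, hv, hw'⟩ := h w hw
  rw [← Finset.mul_prod_erase _ _ hv, ← mul_assoc]
  refine Ideal.mul_mem_right _ _ ?_
  rw [lF, Finset.mul_sum]
  exact Ideal.sum_mem _ fun w' h' => Ideal.subset_span ⟨w, w', hw' w' h', rfl⟩

lemma kSg_congr {R : Type} [CommRing R] (ρ : V → ℕ) (s t : V) (B : Finset V)
    (h : ∀ b ∈ B, (ρ b < ρ s ↔ ρ b < ρ t)) : kSg R ρ s B = kSg R ρ t B := by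
  unfold kSg
  rw [Finset.filter_congr h]

lemma kSg_C (ρ : V → ℕ) (t : V) (T : Finset V) :
    kSg (MvPolynomial V K) ρ t T = C (kSg K ρ t T) := by
  simp [kSg]

/-- Lower/upper selection. -/
def phiSel (lo up : ℕ → V) (j i : ℕ) : V := if i < j then lo i else up i

/-- Lower/alternative selection. -/
def tauSel (lo al : ℕ → V) (ε : Finset ℕ) (i : ℕ) : V := if i ∈ ε then al i else lo i

/-- A set together with a selection. -/
def selSet (U : Finset V) (S : Finset ℕ) (φ : ℕ → V) : Finset V := U ∪ S.image φ

lemma selSet_insert (U : Finset V) (S : Finset ℕ) (φ : ℕ → V) (i : ℕ) (hi : i ∈ S) :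
    selSet U S φ = insert (φ i) (selSet U (S.erase i) φ) := by
  unfold selSet
  conv_lhs => rw [← Finset.insert_erase hi]
  rw [Finset.image_insert, Finset.union_insert]

lemma selSet_congr (U : Finset V) (S : Finset ℕ) (φ ψ : ℕ → V) (h : ∀ i ∈ S, φ i = ψ i) :
    selSet U S φ = selSet U S ψ := by
  unfold selSet
  rw [Finset.image_congr (fun i hi => h i hi)]

lemma mem_selSet (U : Finset V) (S : Finset ℕ) (φ : ℕ → V) (v : V) :
    v ∈ selSet U S φ ↔ v ∈ U ∨ ∃ i ∈ S, φ i = v := by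
  simp [selSet]

/-- The alternating sum over all choices vanishes. -/
lemma alt_sum_zero (k N : ℕ) (ρ : V → ℕ) (U : Finset V) (lo al : ℕ → V) (b : Finset V → K)
    (hU : ∀ u ∈ U, ρ u < N) (hlo : ∀ i < k, ρ (lo i) = N + 3 * i + 1)
    (hal : ∀ i < k, ρ (al i) = N + 3 * i + 2) :
    ∑ ε ∈ (Finset.range k).powerset, (-1 : K) ^ ε.card * ∑ i ∈ Finset.range k,
      kSg K ρ (tauSel lo al ε i) (selSet U (Finset.range k) (tauSel lo al ε)) *
        b ((selSet U (Finset.range k) (tauSel lo al ε)).erase (tauSel lo al ε i)) = 0 := by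
  have hτ : ∀ ε : Finset ℕ, ∀ i < k, ρ (tauSel lo al ε i) = N + 3 * i + 1 ∨
      ρ (tauSel lo al ε i) = N + 3 * i + 2 := by
    intro ε i hi
    unfold tauSel
    split_ifs
    · right; exact hal i hi
    · left; exact hlo i hi
  simp only [Finset.mul_sum]
  rw [Finset.sum_comm]
  refine Finset.sum_eq_zero fun i hi => ?_
  have hik := Finset.mem_range.1 hi
  have herase : ∀ ε : Finset ℕ,
      (selSet U (Finset.range k) (tauSel lo al ε)).erase (tauSel lo al ε i) =
      selSet U ((Finset.range k).erase i) (tauSel lo al ε) := by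
    intro ε
    rw [selSet_insert U _ _ i hi, Finset.erase_insert]
    rw [mem_selSet]
    rintro (h | ⟨i', hi', h⟩)
    · have := hU _ h
      have := hτ ε i hik
      omega
    · rw [Finset.mem_erase, Finset.mem_range] at hi'
      have h1 := hτ ε i hik
      have h2 := hτ ε i' hi'.2
      rw [h] at h2
      omega
  have hi2 : i ∉ (Finset.range k).erase i := by simp
  rw [← Finset.insert_erase hi, Finset.sum_powerset_insert hi2, Finset.insert_erase hi,
    ← Finset.sum_add_distrib]
  refine Finset.sum_eq_zero fun ε hε => ?_
  have hiε : i ∉ ε := fun h => hi2 (Finset.mem_powerset.1 hε h)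
  rw [← kSg_erase_self ρ (tauSel lo al ε i), ← kSg_erase_self ρ (tauSel lo al (insert i ε) i),
    herase, herase, Finset.card_insert_of_notMem hiε]
  have hB : selSet U ((Finset.range k).erase i) (tauSel lo al (insert i ε)) =
      selSet U ((Finset.range k).erase i) (tauSel lo al ε) := by
    refine selSet_congr _ _ _ _ fun i' hi' => ?_
    have : i' ≠ i := (Finset.mem_erase.1 hi').1
    simp [tauSel, this]
  rw [hB]
  have hs : kSg K ρ (tauSel lo al (insert i ε) i)
      (selSet U ((Finset.range k).erase i) (tauSel lo al ε)) =
      kSg K ρ (tauSel lo al ε i) (selSet U ((Finset.range k).erase i) (tauSel lo al ε)) := by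
    refine kSg_congr ρ _ _ _ fun v hv => ?_
    have h1 := hτ ε i hik
    have h2 := hτ (insert i ε) i hik
    rw [mem_selSet] at hv
    rcases hv with h | ⟨i', hi', rfl⟩
    · have := hU _ h
      omega
    · rw [Finset.mem_erase, Finset.mem_range] at hi'
      have h3 := hτ ε i' hi'.2
      omega
  rw [hs]
  ring

/-- The explicit Koszul cochain. -/
noncomputable def kCoc (K : Type) [Field K] (Adj : V → V → Prop) (P : V → Finset V)
    (G : ℕ → Finset V) (k : ℕ) (T : Finset V) : MvPolynomial V K ⧸ edgeIdeal K Adj :=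
  ∑ j ∈ Finset.range (k + 1), if T = G j then
    Ideal.Quotient.mk (edgeIdeal K Adj) (∏ v ∈ G j, lF K P v) else 0

lemma kCoc_closed (Adj : V → V → Prop) (P : V → Finset V) (k N : ℕ) (ρ : V → ℕ) (U : Finset V)
    (lo up : ℕ → V) (y : V → MvPolynomial V K)
    (hU : ∀ u ∈ U, ρ u < N) (hlo : ∀ i < k, ρ (lo i) = N + 3 * i + 1)
    (hup : ∀ i < k, ρ (up i) = N + 3 * i + 3)
    (hy : ∀ v, v ∉ U → y v = lF K P v)
    (hz : ∀ j ≤ k, ∀ t, t ∉ selSet U (Finset.range k) (phiSel lo up j) →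
      (j < k → t ≠ lo j) → (0 < j → t ≠ up (j - 1)) →
      lF K P t * ∏ v ∈ selSet U (Finset.range k) (phiSel lo up j), lF K P v ∈ edgeIdeal K Adj) :
    kD ρ y (kCoc K Adj P (fun j => selSet U (Finset.range k) (phiSel lo up j)) k) = 0 := by
  set G : ℕ → Finset V := fun j => selSet U (Finset.range k) (phiSel lo up j) with hG
  have hφ : ∀ j, ∀ i < k, (i < j ∧ ρ (phiSel lo up j i) = N + 3 * i + 1) ∨
      (j ≤ i ∧ ρ (phiSel lo up j i) = N + 3 * i + 3) := by
    intro j i hi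
    unfold phiSel
    split_ifs with h
    · left; exact ⟨h, hlo i hi⟩
    · right; exact ⟨by omega, hup i hi⟩
  have hmem : ∀ j v, v ∈ G j → ρ v < N ∨ ∃ i < k, (i < j ∧ ρ v = N + 3 * i + 1) ∨
      (j ≤ i ∧ ρ v = N + 3 * i + 3) := by
    intro j v hv
    rcases (mem_selSet _ _ _ _).1 hv with h | ⟨i, hi, rfl⟩
    · left; exact hU _ h
    · right; exact ⟨i, Finset.mem_range.1 hi, hφ j i (Finset.mem_range.1 hi)⟩
  have hloG : ∀ j < k, lo j ∉ G j := by
    intro j hj h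
    have := hlo j hj
    rcases hmem j _ h with h | ⟨i, hi, h⟩ <;> omega
  have hupG : ∀ j < k, up j ∉ G (j + 1) := by
    intro j hj h
    have := hup j hj
    rcases hmem _ _ h with h | ⟨i, hi, h⟩ <;> omega
  have hloU : ∀ j < k, lo j ∉ U := fun j hj h => by
    have := hlo j hj
    have := hU _ h
    omega
  have hupU : ∀ j < k, up j ∉ U := fun j hj h => by
    have := hup j hj
    have := hU _ h
    omega
  let B : ℕ → Finset V := fun j => selSet U ((Finset.range k).erase j) (phiSel lo up j)
  have hGB : ∀ j < k, G j = insert (up j) (B j) := by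
    intro j hj
    have := selSet_insert U (Finset.range k) (phiSel lo up j) j (Finset.mem_range.2 hj)
    rw [show phiSel lo up j j = up j by simp [phiSel]] at this
    exact this
  have hGB' : ∀ j < k, G (j + 1) = insert (lo j) (B j) := by
    intro j hj
    have := selSet_insert U (Finset.range k) (phiSel lo up (j + 1)) j (Finset.mem_range.2 hj)
    rw [show phiSel lo up (j + 1) j = lo j by simp [phiSel]] at this
    rw [hG]
    dsimp only
    rw [this]
    congr 1
    refine selSet_congr _ _ _ _ fun i hi => ?_
    have : i ≠ j := (Finset.mem_erase.1 hi).1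
    unfold phiSel
    by_cases h : i < j
    · rw [if_pos h, if_pos (by omega)]
    · rw [if_neg h, if_neg (by omega)]
  let E : ℕ → Finset V := fun j => insert (lo j) (G j)
  have hE : ∀ j < k, E j = insert (up j) (G (j + 1)) := by
    intro j hj
    simp only [E]
    rw [hGB j hj, hGB' j hj, Finset.insert_comm]
  have hsg : ∀ j < k, kSg (MvPolynomial V K) ρ (up j) (E j) =
      - kSg (MvPolynomial V K) ρ (lo j) (E j) := by
    intro j hj
    have e1 : kSg (MvPolynomial V K) ρ (lo j) (E j) = kSg (MvPolynomial V K) ρ (lo j) (B j) := by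
      rw [← kSg_erase_self, Finset.erase_insert (hloG j hj), hGB j hj, kSg_insert_of_not_lt]
      rw [hup j hj, hlo j hj]; omega
    have hlB : lo j ∉ B j := fun h => hloG j hj (by rw [hGB j hj]; simp [h])
    have e2 : kSg (MvPolynomial V K) ρ (up j) (E j) = - kSg (MvPolynomial V K) ρ (up j) (B j) := by
      rw [← kSg_erase_self, hE j hj, Finset.erase_insert (hupG j hj), hGB' j hj, kSg_insert_of_lt]
      · exact hlB
      · rw [hup j hj, hlo j hj]; omega
    rw [e1, e2]
    congr 1
    refine kSg_congr ρ _ _ _ fun v hv => ?_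
    rw [hlo j hj, hup j hj]
    have hvl : v ≠ lo j := fun h => hlB (h ▸ hv)
    rcases (mem_selSet _ _ _ _).1 hv with h | ⟨i, hi, rfl⟩
    · have := hU _ h
      omega
    · rw [Finset.mem_erase, Finset.mem_range] at hi
      have := hφ j i hi.2
      omega
  ext T
  rw [Pi.zero_apply]
  let mk := Ideal.Quotient.mk (edgeIdeal K Adj)
  let a : ℕ → MvPolynomial V K ⧸ edgeIdeal K Adj := fun j =>
    if T = E j then mk (kSg (MvPolynomial V K) ρ (lo j) (E j) * ∏ v ∈ E j, lF K P v) else 0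
  have hterm : ∀ j ≤ k, ∀ t ∈ T, (kSg (MvPolynomial V K) ρ t T * y t) •
      (if T.erase t = G j then mk (∏ v ∈ G j, lF K P v) else 0) =
      (if t = lo j then (if j < k then a j else 0) else 0) -
      (if t = up (j - 1) then (if 0 < j then a (j - 1) else 0) else 0) := by
    intro j hj t ht
    by_cases hTt : T.erase t = G j
    · have hT : T = insert t (G j) := by rw [← hTt, Finset.insert_erase ht]
      have htG : t ∉ G j := by rw [← hTt]; simp
      have htU : t ∉ U := fun h => htG ((mem_selSet _ _ _ _).2 (Or.inl h))
      rw [if_pos hTt, hy t htU]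
      have hval : (kSg (MvPolynomial V K) ρ t T * lF K P t) • mk (∏ v ∈ G j, lF K P v) =
          mk (kSg (MvPolynomial V K) ρ t T * ∏ v ∈ T, lF K P v) := by
        conv_rhs => rw [hT, Finset.prod_insert htG]
        rw [← hT, ← mul_assoc]
        rfl
      rw [hval]
      by_cases h1 : t = lo j ∧ j < k
      · obtain ⟨rfl, hjk⟩ := h1
        have h2 : ¬ (lo j = up (j - 1) ∧ 0 < j) := by
          rintro ⟨h, h0⟩
          have := hlo j hjk
          have h' := hup (j - 1) (by omega)
          rw [← h] at h'
          omega
        have : (if lo j = up (j - 1) then (if 0 < j then a (j - 1) else 0) else 0) = 0 := by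
          split_ifs with h h' <;> first | rfl | exact absurd ⟨h, h'⟩ h2
        rw [this, if_pos rfl, if_pos hjk, sub_zero]
        simp only [a]
        rw [if_pos hT, hT]
      · have e1 : (if t = lo j then (if j < k then a j else 0) else 0) = 0 := by
          split_ifs with h h' <;> first | rfl | exact absurd ⟨h, h'⟩ h1
        rw [e1, zero_sub]
        by_cases h2 : t = up (j - 1) ∧ 0 < j
        · obtain ⟨rfl, hj0⟩ := h2
          obtain ⟨j, rfl⟩ : ∃ i, j = i + 1 := ⟨j - 1, by omega⟩
          simp only [Nat.add_sub_cancel] at *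
          rw [if_pos trivial, if_pos hj0]
          have hTE : T = E j := by rw [hE j (by omega)]; exact hT
          simp only [a]
          rw [if_pos hTE, hTE, hsg j (by omega), neg_mul, map_neg]
        · have e2 : (if t = up (j - 1) then (if 0 < j then a (j - 1) else 0) else 0) = 0 := by
            split_ifs with h h' <;> first | rfl | exact absurd ⟨h, h'⟩ h2
          rw [e2, neg_zero]
          refine Ideal.Quotient.eq_zero_iff_mem.2 (Ideal.mul_mem_left _ _ ?_)
          rw [hT, Finset.prod_insert htG]
          exact hz j hj t htG (fun h h' => h1 ⟨h', h⟩) (fun h h' => h2 ⟨h', h⟩)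
    · rw [if_neg hTt, smul_zero]
      have e1 : (if t = lo j then (if j < k then a j else 0) else 0) = 0 := by
        split_ifs with h h'
        · simp only [a]
          rw [if_neg]
          rintro rfl
          exact hTt (by rw [h]; exact Finset.erase_insert (hloG j h'))
        · rfl
        · rfl
      have e2 : (if t = up (j - 1) then (if 0 < j then a (j - 1) else 0) else 0) = 0 := by
        split_ifs with h h'
        · obtain ⟨j, rfl⟩ : ∃ i, j = i + 1 := ⟨j - 1, by omega⟩
          simp only [Nat.add_sub_cancel] at *
          simp only [a]
          rw [if_neg]
          intro hT
          refine hTt ?_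
          rw [hT, h, hE j (by omega)]
          exact Finset.erase_insert (hupG j (by omega))
        · rfl
        · rfl
      rw [e1, e2, sub_zero]
  have hsum : ∀ j ≤ k, ∑ t ∈ T, (kSg (MvPolynomial V K) ρ t T * y t) •
      (if T.erase t = G j then mk (∏ v ∈ G j, lF K P v) else 0) =
      (if j < k then a j else 0) - (if 0 < j then a (j - 1) else 0) := by
    intro j hj
    rw [Finset.sum_congr rfl (hterm j hj), Finset.sum_sub_distrib, Finset.sum_ite_eq' T,
      Finset.sum_ite_eq' T]
    congr 1
    · split_ifs with h h'
      · rfl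
      · rfl
      · simp only [a]
        rw [if_neg]
        rintro rfl
        exact h (by simp [E])
      · rfl
    · split_ifs with h h'
      · rfl
      · rfl
      · simp only [a]
        rw [if_neg]
        intro hT
        refine h ?_
        rw [hT, hE (j - 1) (by omega)]
        simp
      · rfl
  have : kD ρ y (kCoc K Adj P G k) T = ∑ j ∈ Finset.range (k + 1), ∑ t ∈ T,
      (kSg (MvPolynomial V K) ρ t T * y t) •
      (if T.erase t = G j then mk (∏ v ∈ G j, lF K P v) else 0) := by
    rw [Finset.sum_comm]
    simp only [kD, kCoc, Finset.smul_sum]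
    rfl
  rw [this, Finset.sum_congr rfl (fun j hj => hsum j (by
    have := Finset.mem_range.1 hj
    omega)), Finset.sum_sub_distrib, Finset.sum_range_succ, Finset.sum_range_succ']
  simp only [lt_irrefl, if_false, add_zero, Nat.add_sub_cancel, Nat.succ_pos, if_true]
  rw [sub_eq_zero]
  refine Finset.sum_congr rfl fun j hj => ?_
  rw [if_pos (Finset.mem_range.1 hj)]

lemma kCoc_not_exact (Adj : V → V → Prop)
    (P : V → Finset V) (k N : ℕ) (ρ : V → ℕ) (U : Finset V)
    (lo up al : ℕ → V) (y : V → MvPolynomial V K)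
    (hU : ∀ u ∈ U, ρ u < N) (hlo : ∀ i < k, ρ (lo i) = N + 3 * i + 1)
    (hal : ∀ i < k, ρ (al i) = N + 3 * i + 2)
    (hup : ∀ i < k, ρ (up i) = N + 3 * i + 3)
    (hy : ∀ v, v ∉ U → y v = lF K P v) (hyU : ∀ v ∈ U, y v = X v ^ 2)
    (hind : ∀ ε, ∀ v ∈ selSet U (Finset.range k) (tauSel lo al ε),
      ∀ w ∈ selSet U (Finset.range k) (tauSel lo al ε), ¬ Adj v w)
    (hP : ∀ ε, ∀ v ∈ selSet U (Finset.range k) (tauSel lo al ε), v ∈ P v ∧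
      ∀ w ∈ P v, w ≠ v → w ∉ selSet U (Finset.range k) (tauSel lo al ε))
    (g : Finset V → MvPolynomial V K ⧸ edgeIdeal K Adj)
    (hg : kD ρ y g = kCoc K Adj P (fun j => selSet U (Finset.range k) (phiSel lo up j)) k) :
    False := by
  choose g' hg' using fun T => Ideal.Quotient.mk_surjective (g T)
  set H : Finset ℕ → Finset V := fun ε => selSet U (Finset.range k) (tauSel lo al ε) with hH
  have hτ : ∀ ε : Finset ℕ, ∀ i < k, ρ (tauSel lo al ε i) = N + 3 * i + 1 ∨
      ρ (tauSel lo al ε i) = N + 3 * i + 2 := by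
    intro ε i hi
    unfold tauSel
    split_ifs
    · right; exact hal i hi
    · left; exact hlo i hi
  have hHne : ∀ ε ∈ (Finset.range k).powerset, ∀ j ≤ k,
      H ε = selSet U (Finset.range k) (phiSel lo up j) ↔ (ε = ∅ ∧ j = k) := by
    intro ε hε j hj
    constructor
    · intro h
      have hjk : j = k := by
        by_contra hjk
        have : up (k - 1) ∈ H ε := by
          rw [h, mem_selSet]
          exact Or.inr ⟨k - 1, Finset.mem_range.2 (by omega), by
            rw [phiSel, if_neg (by omega)]⟩
        have h3 := hup (k - 1) (by omega)
        rcases (mem_selSet _ _ _ _).1 this with h | ⟨i, hi, h⟩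
        · have := hU _ h
          omega
        · have := hτ ε i (Finset.mem_range.1 hi)
          rw [h] at this
          omega
      refine ⟨?_, hjk⟩
      rw [Finset.eq_empty_iff_forall_notMem]
      intro i hi
      have hik := Finset.mem_range.1 (Finset.mem_powerset.1 hε hi)
      have : al i ∈ selSet U (Finset.range k) (phiSel lo up j) := by
        rw [← h, hH, mem_selSet]
        exact Or.inr ⟨i, Finset.mem_range.2 hik, by simp [tauSel, hi]⟩
      have h3 := hal i hik
      rcases (mem_selSet _ _ _ _).1 this with h | ⟨i', hi', h⟩
      · have := hU _ h
        omega
      · have hi'k := Finset.mem_range.1 hi'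
        rw [phiSel, if_pos (by omega)] at h
        have := hlo i' hi'k
        rw [h] at this
        omega
    · rintro ⟨rfl, rfl⟩
      refine selSet_congr _ _ _ _ fun i hi => ?_
      rw [phiSel, if_pos (Finset.mem_range.1 hi)]
      simp [tauSel]
  have hτU : ∀ ε : Finset ℕ, ∀ i < k, tauSel lo al ε i ∉ U := fun ε i hi h => by
    have := hτ ε i hi
    have := hU _ h
    omega
  have hmain : ∀ ε ∈ (Finset.range k).powerset,
      ∑ i ∈ Finset.range k, kSg K ρ (tauSel lo al ε i) (H ε) *
        coeff (eInd ((H ε).erase (tauSel lo al ε i))) (g' ((H ε).erase (tauSel lo al ε i))) =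
      if ε = ∅ then 1 else 0 := by
    intro ε hε
    have h1 := congrFun hg (H ε)
    have h2 : Ideal.Quotient.mk (edgeIdeal K Adj)
        (∑ t ∈ H ε, kSg (MvPolynomial V K) ρ t (H ε) * y t * g' ((H ε).erase t) -
          if ε = ∅ then ∏ v ∈ H ε, lF K P v else 0) = 0 := by
      rw [map_sub, sub_eq_zero, map_sum]
      refine Eq.trans ?_ (h1.trans ?_)
      · refine Finset.sum_congr rfl fun t _ => ?_
        rw [← hg', map_mul]
        rfl
      · rw [kCoc]
        rw [Finset.sum_congr rfl (fun j hj => by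
          rw [if_congr (hHne ε hε j (by
            have := Finset.mem_range.1 hj
            omega)) rfl rfl])]
        by_cases hε0 : ε = ∅
        · rw [if_pos hε0, Finset.sum_eq_single_of_mem k (by simp)]
          · rw [if_pos ⟨hε0, rfl⟩, ← (hHne ε hε k le_rfl).2 ⟨hε0, rfl⟩]
          · intro j _ hj
            rw [if_neg (fun h => hj h.2)]
        · rw [if_neg hε0, map_zero]
          exact Finset.sum_eq_zero fun j _ => if_neg (fun h => hε0 h.1)
    have h3 := coeff_edgeIdeal Adj (H ε) (hind ε) _ (Ideal.Quotient.eq_zero_iff_mem.1 h2)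
    rw [coeff_sub, sub_eq_zero, coeff_sum] at h3
    have h4 : coeff (eInd (H ε)) (if ε = ∅ then ∏ v ∈ H ε, lF K P v else 0) =
        if ε = ∅ then (1 : K) else 0 := by
      split_ifs
      · exact coeff_prod_lF P _ (hP ε)
      · simp
    rw [h4] at h3
    rw [← h3]
    have hdisj : Disjoint U ((Finset.range k).image (tauSel lo al ε)) := by
      rw [Finset.disjoint_left]
      intro v hv hv'
      obtain ⟨i, hi, rfl⟩ := Finset.mem_image.1 hv'
      exact hτU ε i (Finset.mem_range.1 hi) hv
    conv_rhs => rw [hH]; dsimp only; rw [selSet, Finset.sum_union hdisj]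
    rw [Finset.sum_eq_zero (s := U), zero_add, Finset.sum_image]
    · refine Finset.sum_congr rfl fun i hi => ?_
      have hik := Finset.mem_range.1 hi
      have hm : tauSel lo al ε i ∈ H ε := (mem_selSet _ _ _ _).2 (Or.inr ⟨i, hi, rfl⟩)
      change _ = coeff (eInd (H ε)) (kSg _ ρ (tauSel lo al ε i) (H ε) * y (tauSel lo al ε i) *
        g' ((H ε).erase (tauSel lo al ε i)))
      rw [kSg_C, mul_assoc, coeff_C_mul, hy _ (hτU ε i hik),
        coeff_lF_mul P _ _ hm (hP ε _ hm).1 (hP ε _ hm).2]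
    · intro i hi i' hi' h
      have h1 := hτ ε i (Finset.mem_range.1 hi)
      have h2 := hτ ε i' (Finset.mem_range.1 hi')
      rw [h] at h1
      omega
    · intro u hu
      rw [hyU u hu, kSg_C, mul_assoc, coeff_C_mul]
      change _ * coeff (eInd (H ε)) _ = 0
      rw [coeff_sq_mul, mul_zero]
  have hz := alt_sum_zero (K := K) k N ρ U lo al (fun T => coeff (eInd T) (g' T)) hU hlo hal
  rw [Finset.sum_congr rfl (fun ε hε => by
    have := hmain ε hε
    simp only [hH] at this
    rw [this]), Finset.sum_eq_single_of_mem ∅ (by simp)] at hz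
  · simp at hz
  · intro ε _ h
    simp [h]

theorem length_le_abstract [Fintype V] (Adj : V → V → Prop)
    (P : V → Finset V) (k N : ℕ) (ρ : V → ℕ) (hρ : Function.Injective ρ) (U : Finset V)
    (lo up al : ℕ → V)
    (hU : ∀ u ∈ U, ρ u < N) (hlo : ∀ i < k, ρ (lo i) = N + 3 * i + 1)
    (hal : ∀ i < k, ρ (al i) = N + 3 * i + 2)
    (hup : ∀ i < k, ρ (up i) = N + 3 * i + 3)
    (hind : ∀ ε, ∀ v ∈ selSet U (Finset.range k) (tauSel lo al ε),
      ∀ w ∈ selSet U (Finset.range k) (tauSel lo al ε), ¬ Adj v w)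
    (hP : ∀ ε, ∀ v ∈ selSet U (Finset.range k) (tauSel lo al ε), v ∈ P v ∧
      ∀ w ∈ P v, w ≠ v → w ∉ selSet U (Finset.range k) (tauSel lo al ε))
    (hrad : ∀ v, v ∉ U → ∃ v', v' ∉ U ∧ v ∈ P v' ∧ ∀ w ∈ P v', w ≠ v → Adj v w)
    (hz : ∀ j ≤ k, ∀ t, t ∉ selSet U (Finset.range k) (phiSel lo up j) →
      (j < k → t ≠ lo j) → (0 < j → t ≠ up (j - 1)) →
      ∀ w ∈ P t, ∃ v ∈ selSet U (Finset.range k) (phiSel lo up j), ∀ w' ∈ P v, Adj w w') :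
    rdepth K V (MvPolynomial V K ⧸ edgeIdeal K Adj) ≤ U.card + k := by
  refine csSup_le' ?_
  rintro d ⟨rs, rfl, hrs, hreg⟩
  by_contra hlt
  push Not at hlt
  let y : V → MvPolynomial V K := fun v => if v ∈ U then X v ^ 2 else lF K P v
  have hy : ∀ v, v ∉ U → y v = lF K P v := fun v hv => if_neg hv
  have hyU : ∀ v ∈ U, y v = X v ^ 2 := fun v hv => if_pos hv
  set J : Ideal (MvPolynomial V K) := Ideal.span (Set.range y) ⊔ edgeIdeal K Adj with hJ
  have hXJ : Ideal.span (Set.range (X : V → MvPolynomial V K)) ≤ J.radical := by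
    rw [Ideal.span_le]
    rintro _ ⟨v, rfl⟩
    refine ⟨2, ?_⟩
    by_cases hv : v ∈ U
    · rw [← hyU v hv]
      exact Ideal.mem_sup_left (Ideal.subset_span ⟨v, rfl⟩)
    · obtain ⟨v', hv', hvP, hadj⟩ := hrad v hv
      have e : X v * y v' = (X v ^ 2 : MvPolynomial V K) + ∑ w ∈ (P v').erase v, X v * X w := by
        rw [hy v' hv', lF, ← Finset.add_sum_erase _ _ hvP, mul_add, Finset.mul_sum, pow_two]
      rw [← sub_eq_iff_eq_add] at e
      rw [← e]
      refine Ideal.sub_mem _ (Ideal.mem_sup_left (Ideal.mul_mem_left _ _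
        (Ideal.subset_span ⟨v', rfl⟩))) (Ideal.mem_sup_right (Ideal.sum_mem _ fun w hw => ?_))
      rw [Finset.mem_erase] at hw
      exact Ideal.subset_span ⟨v, w, hadj w hw.2 hw.1, rfl⟩
  have hpow : ∀ r ∈ rs, ∃ s : ℕ, ∃ a : V → MvPolynomial V K,
      ∀ m : MvPolynomial V K ⧸ edgeIdeal K Adj, r ^ s • m = (∑ t, a t * y t) • m := by
    intro r hr
    obtain ⟨s, hs⟩ := hXJ (hrs r hr)
    obtain ⟨p, hp, q, hq, hpq⟩ := Submodule.mem_sup.1 hs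
    obtain ⟨a, ha⟩ := Ideal.mem_span_range_iff_exists_fun.1 hp
    refine ⟨s, a, fun m => ?_⟩
    rw [ha, ← hpq, add_smul]
    obtain ⟨m, rfl⟩ := Ideal.Quotient.mk_surjective m
    have : q • (Ideal.Quotient.mk (edgeIdeal K Adj) m) = 0 :=
      Ideal.Quotient.eq_zero_iff_mem.2 (Ideal.mul_mem_right _ _ hq)
    rw [this, add_zero]
  have hcard : ∀ j, (selSet U (Finset.range k) (phiSel lo up j)).card = U.card + k := by
    intro j
    have hφ : ∀ i < k, ρ (phiSel lo up j i) = N + 3 * i + 1 ∨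
        ρ (phiSel lo up j i) = N + 3 * i + 3 := by
      intro i hi
      unfold phiSel
      split_ifs with h
      · left; exact hlo i hi
      · right; exact hup i hi
    rw [selSet, Finset.card_union_of_disjoint, Finset.card_image_of_injOn, Finset.card_range]
    · intro i hi i' hi' h
      have h1 := hφ i (Finset.mem_range.1 hi)
      have h2 := hφ i' (Finset.mem_range.1 hi')
      rw [h] at h1
      omega
    · rw [Finset.disjoint_left]
      intro v hv hv'
      obtain ⟨i, hi, rfl⟩ := Finset.mem_image.1 hv'
      have := hφ i (Finset.mem_range.1 hi)
      have := hU _ hv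
      omega
  obtain ⟨g, -, hg⟩ := koszul_vanish ρ hρ y rs _ hpow hreg.toIsWeaklyRegular (U.card + k) hlt
    (kCoc K Adj P (fun j => selSet U (Finset.range k) (phiSel lo up j)) k)
    (fun T hT => Finset.sum_eq_zero fun j _ => if_neg (by
      rintro rfl
      exact hT (hcard j)))
    (kCoc_closed Adj P k N ρ U lo up y hU hlo hup hy
      (fun j hj t h1 h2 h3 => lF_mul_prod_mem Adj P _ t (hz j hj t h1 h2 h3)))
  exact kCoc_not_exact Adj P k N ρ U lo up al y hU hlo hal hup hy hyU hind hP g hg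

end Abstract

section Concrete

lemma cAdj_iff (n m : ℕ) (a b : Fin n × Fin m) : cAdj n m a b ↔
    ((a.1 : ℕ) ≠ b.1 ∨ (a.2 : ℕ) ≠ b.2) ∧
    (((a.1 : ℕ) ≤ b.1 + 1 ∧ (b.1 : ℕ) ≤ a.1 + 1) ∨ (a.1 : ℕ) + n ≤ b.1 + 1 ∨
      (b.1 : ℕ) + n ≤ a.1 + 1) ∧ (a.2 : ℕ) ≤ b.2 + 1 ∧ (b.2 : ℕ) ≤ a.2 + 1 := by
  have hne : a ≠ b ↔ ((a.1 : ℕ) ≠ b.1 ∨ (a.2 : ℕ) ≠ b.2) := by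
    rw [Ne, Prod.ext_iff, Fin.ext_iff, Fin.ext_iff]
    tauto
  have := a.1.2
  have := b.1.2
  rw [cAdj, hne, abs_le]
  refine and_congr_right fun _ => and_congr ?_ ?_ <;> omega

/-- The vertex in column `i` and row `j`. -/
def vtx (n m : ℕ) (hn : 3 ≤ n) (hm : 1 ≤ m) (i j : ℕ) : Fin n × Fin m :=
  (⟨i % n, Nat.mod_lt _ (by omega)⟩, ⟨j % m, Nat.mod_lt _ (by omega)⟩)

lemma vtx_fst (n m : ℕ) (hn : 3 ≤ n) (hm : 1 ≤ m) (i j : ℕ) (hi : i < n) :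
    ((vtx n m hn hm i j).1 : ℕ) = i := Nat.mod_eq_of_lt hi

lemma vtx_snd (n m : ℕ) (hn : 3 ≤ n) (hm : 1 ≤ m) (i j : ℕ) (hj : j < m) :
    ((vtx n m hn hm i j).2 : ℕ) = j := Nat.mod_eq_of_lt hj

lemma eq_vtx (n m : ℕ) (hn : 3 ≤ n) (hm : 1 ≤ m) (i j : ℕ) (hi : i < n) (hj : j < m)
    (v : Fin n × Fin m) (h1 : (v.1 : ℕ) = i) (h2 : (v.2 : ℕ) = j) : v = vtx n m hn hm i j := by
  refine Prod.ext (Fin.ext ?_) (Fin.ext ?_)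
  · rw [vtx_fst _ _ _ _ _ _ hi, h1]
  · rw [vtx_snd _ _ _ _ _ _ hj, h2]

/-- Row-by-row product of dominating independent sets. -/
def domU (n m : ℕ) (hn : 3 ≤ n) (hm : 1 ≤ m) (Q : ℕ) : Finset (Fin n × Fin m) :=
  (Finset.range Q ×ˢ Finset.range ((n + 2) / 3)).image fun p =>
    vtx n m hn hm (min (3 * p.2) (n - 2)) (min (3 * p.1 + 1) (m - 1))

lemma mem_domU (n m : ℕ) (hn : 3 ≤ n) (hm : 1 ≤ m) (Q : ℕ) (v : Fin n × Fin m) :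
    v ∈ domU n m hn hm Q ↔ ∃ l i, l < Q ∧ i < (n + 2) / 3 ∧
      (v.1 : ℕ) = min (3 * i) (n - 2) ∧ (v.2 : ℕ) = min (3 * l + 1) (m - 1) := by
  rw [domU, Finset.mem_image]
  constructor
  · rintro ⟨⟨l, i⟩, h, rfl⟩
    rw [Finset.mem_product, Finset.mem_range, Finset.mem_range] at h
    exact ⟨l, i, h.1, h.2, vtx_fst _ _ _ _ _ _ (by dsimp only; omega),
      vtx_snd _ _ _ _ _ _ (by dsimp only; omega)⟩
  · rintro ⟨l, i, hl, hi, h1, h2⟩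
    refine ⟨(l, i), by simp [hl, hi], ?_⟩
    exact (eq_vtx _ _ _ _ _ _ (by omega) (by omega) v h1 h2).symm

lemma domU_card (n m : ℕ) (hn : 3 ≤ n) (hm : 1 ≤ m) (Q : ℕ) :
    (domU n m hn hm Q).card ≤ Q * ((n + 2) / 3) := by
  refine Finset.card_image_le.trans ?_
  simp

/-- Blocks of variables. -/
def blk (n m r0 : ℕ) (v : Fin n × Fin m) : Finset (Fin n × Fin m) :=
  Finset.univ.filter fun w => (w.1 : ℕ) = v.1 ∧
    (((v.2 : ℕ) < r0 ∧ (w.2 : ℕ) = v.2) ∨ ((v.2 : ℕ) = r0 ∧ r0 ≤ (w.2 : ℕ)))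

lemma mem_blk (n m r0 : ℕ) (v w : Fin n × Fin m) : w ∈ blk n m r0 v ↔ (w.1 : ℕ) = v.1 ∧
    (((v.2 : ℕ) < r0 ∧ (w.2 : ℕ) = v.2) ∨ ((v.2 : ℕ) = r0 ∧ r0 ≤ (w.2 : ℕ))) := by
  simp [blk]

lemma eq_of_val {n m : ℕ} (v w : Fin n × Fin m) (h1 : (v.1 : ℕ) = w.1) (h2 : (v.2 : ℕ) = w.2) :
    v = w := Prod.ext (Fin.ext h1) (Fin.ext h2)

/-- Row-major rank. -/
def rowRank (n m : ℕ) (v : Fin n × Fin m) : ℕ := v.1 + n * v.2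

lemma rowRank_inj (n m : ℕ) : Function.Injective (rowRank n m) := by
  intro v w h
  unfold rowRank at h
  have h1 := v.1.2
  have h2 := w.1.2
  have e1 : (v.1 + n * v.2 : ℕ) % n = v.1 := by
    rw [Nat.add_mul_mod_self_left, Nat.mod_eq_of_lt h1]
  have e2 : (w.1 + n * w.2 : ℕ) % n = w.1 := by
    rw [Nat.add_mul_mod_self_left, Nat.mod_eq_of_lt h2]
  have e : (v.1 : ℕ) = w.1 := by rw [← e1, ← e2, h]
  refine eq_of_val _ _ e ?_
  have : n * (v.2 : ℕ) = n * w.2 := by omega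
  exact Nat.eq_of_mul_eq_mul_left (by omega) this

lemma rowRank_lt (n m r : ℕ) (v : Fin n × Fin m) (h : (v.2 : ℕ) < r) : rowRank n m v < n * r := by
  unfold rowRank
  have h1 := v.1.2
  have : n * ((v.2 : ℕ) + 1) ≤ n * r := Nat.mul_le_mul_left n h
  rw [Nat.mul_add] at this
  omega

lemma domU_indep (n m : ℕ) (hn : 3 ≤ n) (hm : 1 ≤ m) (Q : ℕ) (hQ : Q ≤ (m + 2) / 3)
    (v : Fin n × Fin m) (hv : v ∈ domU n m hn hm Q) (w : Fin n × Fin m)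
    (hw : w ∈ domU n m hn hm Q) : ¬ cAdj n m v w := by
  rw [mem_domU] at hv hw
  obtain ⟨l, i, hl, hi, h1, h2⟩ := hv
  obtain ⟨l', i', hl', hi', h1', h2'⟩ := hw
  rw [cAdj_iff, h1, h2, h1', h2']
  rintro ⟨hne, hc, hr⟩
  have e1 : l = l' := by omega
  have e2 : i = i' := by omega
  subst e1 e2
  omega

lemma domU_dom (n m : ℕ) (hn : 3 ≤ n) (hm : 1 ≤ m) (Q : ℕ)
    (t : Fin n × Fin m) (ht : t ∉ domU n m hn hm Q) (hr : (t.2 : ℕ) < 3 * Q) :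
    ∃ u ∈ domU n m hn hm Q, cAdj n m t u := by
  have h1 := t.1.2
  have h2 := t.2.2
  let i := if ((t.1 : ℕ) + 1) / 3 < (n + 2) / 3 then ((t.1 : ℕ) + 1) / 3 else 0
  have hi : i < (n + 2) / 3 ∧ (((t.1 : ℕ) ≤ min (3 * i) (n - 2) + 1 ∧
      min (3 * i) (n - 2) ≤ (t.1 : ℕ) + 1) ∨
      (min (3 * i) (n - 2)) + n ≤ t.1 + 1) := by
    simp only [i]
    split_ifs with h
    · omega
    · omega
  let l := (t.2 : ℕ) / 3
  have hl : l < Q ∧ (t.2 : ℕ) ≤ min (3 * l + 1) (m - 1) + 1 ∧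
      min (3 * l + 1) (m - 1) ≤ (t.2 : ℕ) + 1 := by
    simp only [l]
    omega
  have e1 := vtx_fst n m hn hm (min (3 * i) (n - 2)) (min (3 * l + 1) (m - 1)) (by omega)
  have e2 := vtx_snd n m hn hm (min (3 * i) (n - 2)) (min (3 * l + 1) (m - 1)) (by omega)
  have hu : vtx n m hn hm (min (3 * i) (n - 2)) (min (3 * l + 1) (m - 1)) ∈ domU n m hn hm Q :=
    (mem_domU _ _ _ _ _ _).2 ⟨l, i, hl.1, hi.1, e1, e2⟩
  refine ⟨_, hu, ?_⟩
  rw [cAdj_iff]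
  refine ⟨?_, ?_, ?_⟩
  · by_contra hc
    push Not at hc
    exact ht (eq_of_val _ _ hc.1 hc.2 ▸ hu)
  · rw [e1]; omega
  · rw [e2]; omega

lemma case_A (K : Type) [Field K] (n m : ℕ) (hn : 3 ≤ n) (hm : 1 ≤ m) :
    rdepth K (Fin n × Fin m) (MvPolynomial (Fin n × Fin m) K ⧸ edgeIdeal K (cAdj n m)) ≤
      ((m + 2) / 3) * ((n + 2) / 3) := by
  have hs : ∀ φ : ℕ → Fin n × Fin m, selSet (domU n m hn hm ((m + 2) / 3)) (Finset.range 0) φ =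
      domU n m hn hm ((m + 2) / 3) := fun φ => by simp [selSet]
  have hb : ∀ v w : Fin n × Fin m, w ∈ blk n m m v ↔ w = v := by
    intro v w
    have := v.2.2
    rw [mem_blk]
    constructor
    · rintro ⟨h1, h2⟩
      exact eq_of_val _ _ h1 (by omega)
    · rintro rfl
      exact ⟨rfl, Or.inl ⟨this, rfl⟩⟩
  refine le_trans ?_ (domU_card n m hn hm ((m + 2) / 3))
  refine length_le_abstract (cAdj n m) (blk n m m) 0 (n * m) (rowRank n m) (rowRank_inj n m)
    (domU n m hn hm ((m + 2) / 3)) (fun _ => vtx n m hn hm 0 0) (fun _ => vtx n m hn hm 0 0)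
    (fun _ => vtx n m hn hm 0 0) (fun u _ => rowRank_lt n m m u u.2.2) (by simp) (by simp)
    (by simp) ?_ ?_ ?_ ?_
  · intro ε v hv w hw
    rw [hs] at hv hw
    exact domU_indep n m hn hm _ le_rfl v hv w hw
  · intro ε v hv
    exact ⟨(hb v v).2 rfl, fun w hw h => absurd ((hb v w).1 hw) h⟩
  · intro v hv
    exact ⟨v, hv, (hb v v).2 rfl, fun w hw h => absurd ((hb v w).1 hw) h⟩
  · intro j _ t ht _ _ w hw
    rw [hs] at ht
    rw [(hb _ _).1 hw]
    have := t.2.2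
    obtain ⟨u, hu, h⟩ := domU_dom n m hn hm ((m + 2) / 3) t ht (by omega)
    refine ⟨u, by rw [hs]; exact hu, fun w' hw' => ?_⟩
    rw [(hb _ _).1 hw']
    exact h

lemma case_B (K : Type) [Field K] (n m k q : ℕ) (hn : 3 ≤ n) (hm : 1 ≤ m) (hk : n = 3 * k + 1)
    (hq : m = 3 * q + 1 ∨ m = 3 * q + 2) :
    rdepth K (Fin n × Fin m) (MvPolynomial (Fin n × Fin m) K ⧸ edgeIdeal K (cAdj n m)) ≤
      q * ((n + 2) / 3) + k := by
  refine le_trans ?_ (Nat.add_le_add_right (domU_card n m hn hm q) k)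
  have hUrow : ∀ u ∈ domU n m hn hm q, (u.2 : ℕ) + 2 ≤ 3 * q := by
    intro u hu
    obtain ⟨l, i, hl, hi, h1, h2⟩ := (mem_domU _ _ _ _ _ _).1 hu
    omega
  have hf : ∀ c, c < n → ((vtx n m hn hm c (3 * q)).1 : ℕ) = c :=
    fun c hc => vtx_fst _ _ _ _ _ _ hc
  have hsn : ∀ c, ((vtx n m hn hm c (3 * q)).2 : ℕ) = 3 * q :=
    fun c => vtx_snd _ _ _ _ _ _ (by omega)
  have hrank : ∀ c, c < n → rowRank n m (vtx n m hn hm c (3 * q)) = n * (3 * q) + c := by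
    intro c hc
    rw [rowRank, hf c hc, hsn, add_comm]
  set lo : ℕ → Fin n × Fin m := fun i => vtx n m hn hm (3 * i + 1) (3 * q) with hlo
  set al : ℕ → Fin n × Fin m := fun i => vtx n m hn hm (3 * i + 2) (3 * q) with hal
  set up : ℕ → Fin n × Fin m := fun i => vtx n m hn hm (3 * i + 3) (3 * q) with hup
  have hmemH : ∀ ε v, v ∈ selSet (domU n m hn hm q) (Finset.range k) (tauSel lo al ε) →
      v ∈ domU n m hn hm q ∨ ((v.2 : ℕ) = 3 * q ∧ ∃ i < k, v = tauSel lo al ε i ∧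
        ((v.1 : ℕ) = 3 * i + 1 ∨ (v.1 : ℕ) = 3 * i + 2)) := by
    intro ε v hv
    rcases (mem_selSet _ _ _ _).1 hv with h | ⟨i, hi, rfl⟩
    · exact Or.inl h
    · have hik := Finset.mem_range.1 hi
      right
      have : ((tauSel lo al ε i).2 : ℕ) = 3 * q ∧ (((tauSel lo al ε i).1 : ℕ) = 3 * i + 1 ∨
          ((tauSel lo al ε i).1 : ℕ) = 3 * i + 2) := by
        unfold tauSel
        split_ifs
        · exact ⟨hsn _, Or.inr (hf _ (by omega))⟩
        · exact ⟨hsn _, Or.inl (hf _ (by omega))⟩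
      exact ⟨this.1, i, hik, rfl, this.2⟩
  refine length_le_abstract (cAdj n m) (blk n m (3 * q)) k (n * (3 * q)) (rowRank n m)
    (rowRank_inj n m) (domU n m hn hm q) lo up al
    (fun u hu => rowRank_lt n m _ u (by
      have := hUrow u hu
      omega))
    (fun i hi => hrank _ (by omega)) (fun i hi => hrank _ (by omega))
    (fun i hi => hrank _ (by omega)) ?_ ?_ ?_ ?_
  · intro ε v hv w hw hadj
    have hadj' := (cAdj_iff _ _ _ _).1 hadj
    obtain ⟨hne, hc, hr⟩ := hadj'
    rcases hmemH ε v hv with h | ⟨h, i, hi, hvi, hi'⟩ <;>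
      rcases hmemH ε w hw with h2 | ⟨h2, i2, hi2, hvi2, hi2'⟩
    · exact domU_indep n m hn hm q (by omega) v h w h2 hadj
    · have := hUrow v h
      omega
    · have := hUrow w h2
      omega
    · have : i = i2 := by omega
      subst this
      rw [← hvi2] at hvi
      rw [hvi] at hne
      simp at hne
  · intro ε v hv
    rcases hmemH ε v hv with h | ⟨h, i, hi, hvi, hi'⟩
    · have hr := hUrow v h
      refine ⟨(mem_blk _ _ _ _ _).2 ⟨rfl, Or.inl ⟨by omega, rfl⟩⟩, fun w hw hne => ?_⟩
      have hw := (mem_blk _ _ _ _ _).1 hw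
      exact absurd (eq_of_val _ _ hw.1 (by omega)) hne
    · refine ⟨(mem_blk _ _ _ _ _).2 ⟨rfl, Or.inr ⟨h, by omega⟩⟩, fun w hw hne hwH => ?_⟩
      have hw := (mem_blk _ _ _ _ _).1 hw
      have hw2 : (w.2 : ℕ) ≠ v.2 := fun e => hne (eq_of_val _ _ hw.1 e)
      rcases hmemH ε w hwH with h' | ⟨h', _⟩
      · have := hUrow w h'
        omega
      · omega
  · intro v hv
    have hv1 := v.1.2
    have hv2 := v.2.2
    by_cases hr : (v.2 : ℕ) < 3 * q
    · refine ⟨v, hv, (mem_blk _ _ _ _ _).2 ⟨rfl, Or.inl ⟨hr, rfl⟩⟩, fun w hw hne => ?_⟩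
      have hw := (mem_blk _ _ _ _ _).1 hw
      exact absurd (eq_of_val _ _ hw.1 (by omega)) hne
    · refine ⟨vtx n m hn hm v.1 (3 * q), fun h => ?_, ?_, fun w hw hne => ?_⟩
      · have := hUrow _ h
        rw [hsn] at this
        omega
      · rw [mem_blk, hf _ hv1, hsn]
        omega
      · rw [mem_blk, hf _ hv1, hsn] at hw
        have hw2 := w.2.2
        have : (w.2 : ℕ) ≠ v.2 := fun e => hne (eq_of_val _ _ hw.1 e)
        rw [cAdj_iff]
        omega
  · intro j hj t ht h1 h2 w hw
    have ht1 := t.1.2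
    have ht2 := t.2.2
    have hw2 := w.2.2
    rw [mem_blk] at hw
    rcases hw with ⟨hw1, ⟨hr, hwr⟩ | ⟨hr, hwr⟩⟩
    · have : w = t := eq_of_val _ _ hw1 hwr
      subst this
      obtain ⟨u, hu, h⟩ := domU_dom n m hn hm q w
        (fun h => ht ((mem_selSet _ _ _ _).2 (Or.inl h))) hr
      refine ⟨u, (mem_selSet _ _ _ _).2 (Or.inl hu), fun w' hw' => ?_⟩
      have hur := hUrow u hu
      rw [mem_blk] at hw'
      have : w' = u := eq_of_val _ _ hw'.1 (by omega)
      rw [this]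
      exact h
    · have h1' : j < k → (t.1 : ℕ) ≠ 3 * j + 1 := fun hjk e =>
        h1 hjk (eq_vtx _ _ _ _ _ _ (by omega) (by omega) t e hr)
      have h2' : 0 < j → (t.1 : ℕ) ≠ 3 * j := fun hj0 e =>
        h2 hj0 (eq_vtx _ _ _ _ _ _ (by omega) (by omega) t (by omega) hr)
      have hex : ∃ i < k, ∃ c, c < n ∧ phiSel lo up j i = vtx n m hn hm c (3 * q) ∧
          (((t.1 : ℕ) ≤ c + 1 ∧ c ≤ t.1 + 1) ∨ (t.1 : ℕ) + n ≤ c + 1) := by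
        by_cases hc : (t.1 : ℕ) < 3 * j
        · refine ⟨(t.1 : ℕ) / 3, by omega, 3 * ((t.1 : ℕ) / 3) + 1, by omega, ?_, by omega⟩
          rw [phiSel, if_pos (by omega)]
        · by_cases hc' : 3 * j + 2 ≤ (t.1 : ℕ)
          · refine ⟨((t.1 : ℕ) - 2) / 3, by omega, 3 * (((t.1 : ℕ) - 2) / 3) + 3, by omega, ?_,
              by omega⟩
            rw [phiSel, if_neg (by omega)]
          · have hj0 : j = 0 ∧ (t.1 : ℕ) = 0 := by
              by_cases hjk : j < k
              · have := h1' hjk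
                by_cases hj0 : 0 < j
                · have := h2' hj0
                  omega
                · omega
              · have := h2' (by omega)
                omega
            refine ⟨k - 1, by omega, 3 * (k - 1) + 3, by omega, ?_, by omega⟩
            rw [phiSel, if_neg (by omega)]
      obtain ⟨i, hi, c, hc, hφ, hadj⟩ := hex
      have hm' : phiSel lo up j i ∈ selSet (domU n m hn hm q) (Finset.range k) (phiSel lo up j) :=
        (mem_selSet _ _ _ _).2 (Or.inr ⟨i, Finset.mem_range.2 hi, rfl⟩)
      refine ⟨_, hm', fun w' hw' => ?_⟩
      have hne : (t.1 : ℕ) ≠ c := fun e => ht (by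
        rw [eq_vtx n m hn hm c (3 * q) hc (by omega) t e hr, ← hφ]
        exact hm')
      have hw'2 := w'.2.2
      rw [hφ, mem_blk, hf c hc, hsn] at hw'
      rw [cAdj_iff]
      omega

end Concrete

/-- Let `n ≥ 3`, `m ≥ 1`. If `m ≡ 1, 2 (mod 3)` then
`depth(S_{n,m}/I(C_{n,m})) ≤ ⌈(n−1)/3⌉ + (⌈m/3⌉ − 1)⌈n/3⌉`; if `m ≡ 0 (mod 3)` then
`depth(S_{n,m}/I(C_{n,m})) ≤ ⌈n/3⌉⌈m/3⌉`. -/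
theorem depth_quotient_edgeIdeal_C_le (K : Type) [Field K] (n m : ℕ)
    (hn : 3 ≤ n) (hm : 1 ≤ m) :
    (m % 3 = 1 ∨ m % 3 = 2 →
      rdepth K (Fin n × Fin m)
          (MvPolynomial (Fin n × Fin m) K ⧸ edgeIdeal K (cAdj n m)) ≤
        (n - 1 + 2) / 3 + ((m + 2) / 3 - 1) * ((n + 2) / 3)) ∧
    (m % 3 = 0 →
      rdepth K (Fin n × Fin m)
          (MvPolynomial (Fin n × Fin m) K ⧸ edgeIdeal K (cAdj n m)) ≤
        ((n + 2) / 3) * ((m + 2) / 3)) := by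
  have hA := case_A K n m hn hm
  refine ⟨fun h => ?_, fun _ => ?_⟩
  · by_cases h1 : n % 3 = 1
    · have hB := case_B K n m (n / 3) (m / 3) hn hm (by omega) (by omega)
      have e1 : (n - 1 + 2) / 3 = n / 3 := by omega
      have e2 : (m + 2) / 3 - 1 = m / 3 := by omega
      rw [e1, e2, add_comm]
      exact hB
    · have e1 : (n - 1 + 2) / 3 = (n + 2) / 3 := by omega
      obtain ⟨c, hc⟩ : ∃ c, (m + 2) / 3 = c + 1 := ⟨(m + 2) / 3 - 1, by omega⟩
      rw [hc] at hA ⊢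
      rw [e1, Nat.add_sub_cancel, add_comm, ← Nat.succ_mul]
      exact hA
  · rw [mul_comm]
    exact hA
end

section
/- For all integers n ≥ 3 and m ≥ 1, sdepth(S_{n,m}/I(C_{n,m})) ≤ ⌈n/3⌉·⌈m/3⌉. -/
open MvPolynomial

/-- Substitution killing the variables outside `F`, on monomials. -/
theorem kill_monomial (K : Type) [Field K] {σ : Type} [DecidableEq σ] (F : Finset σ)
    (u : σ →₀ ℕ) :
    aeval (fun x => if x ∈ F then (X x : MvPolynomial σ K) else 0) (monomial u (1 : K)) =
      if u.support ⊆ F then monomial u (1 : K) else 0 := by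
  rw [aeval_monomial, map_one, one_mul]
  split_ifs with h
  · rw [monomial_eq, map_one, one_mul]
    refine Finset.prod_congr rfl fun x hx => ?_
    simp [h hx]
  · obtain ⟨x, hx, hxF⟩ := Finset.not_subset.mp h
    refine Finset.prod_eq_zero hx ?_
    simp only [hxF, if_false]
    exact zero_pow (Finsupp.mem_support_iff.mp hx)

/-- The Stanley depth of the quotient by an edge ideal is at most the size of any
independent dominating set. -/
theorem sdepth_le_card (K : Type) [Field K] {σ : Type} [DecidableEq σ]
    (Adj : σ → σ → Prop) (F : Finset σ)
    (hind : ∀ a ∈ F, ∀ b ∈ F, ¬ Adj a b)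
    (hdom : ∀ x, x ∉ F → ∃ y ∈ F, Adj x y) :
    sdepth K σ (MvPolynomial σ K ⧸ edgeIdeal K Adj) ≤ F.card := by
  refine csSup_le' ?_
  rintro d ⟨r, w, A, ⟨hfree, -, htop⟩, rfl⟩
  by_contra hlt
  push Not at hlt
  have hcard : ∀ i, F.card < (A i).card := fun i =>
    lt_of_lt_of_le hlt (Nat.sInf_le ⟨i, rfl⟩)
  have hmiss : ∀ i, ∃ b ∈ F, b ∉ A i := by
    intro i
    by_contra hcon
    push Not at hcon
    obtain ⟨x, hxA, hxF⟩ := Finset.exists_mem_notMem_of_card_lt_card (hcard i)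
    obtain ⟨y, hyF, hxy⟩ := hdom x hxF
    have h0 : (X x * X y : MvPolynomial σ K) = 0 := by
      refine hfree i _ ?_ ?_
      · intro z hz
        have := vars_mul (X x : MvPolynomial σ K) (X y) hz
        rw [vars_X, vars_X] at this
        simp only [Finset.mem_union, Finset.mem_singleton] at this
        rcases this with rfl | rfl
        · exact hxA
        · exact hcon _ hyF
      · obtain ⟨p, hp⟩ := Ideal.Quotient.mk_surjective (w i)
        rw [← hp]
        change Ideal.Quotient.mk _ (X x * X y * p) = 0
        rw [Ideal.Quotient.eq_zero_iff_mem]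
        exact Ideal.mul_mem_right _ _ (Ideal.subset_span ⟨x, y, hxy, rfl⟩)
    exact mul_ne_zero (X_ne_zero x) (X_ne_zero y) h0
  choose b hbF hbA using hmiss
  let φ : MvPolynomial σ K →ₐ[K] MvPolynomial σ K :=
    aeval (fun x => if x ∈ F then (X x : MvPolynomial σ K) else 0)
  have hker : ∀ a ∈ edgeIdeal K Adj, φ a = 0 := by
    have : edgeIdeal K Adj ≤ RingHom.ker φ := by
      refine Ideal.span_le.mpr ?_
      rintro _ ⟨x, y, hxy, rfl⟩
      simp only [SetLike.mem_coe, RingHom.mem_ker, map_mul, φ, aeval_X]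
      by_cases hx : x ∈ F
      · by_cases hy : y ∈ F
        · exact absurd hxy (hind x hx y hy)
        · simp [hy]
      · simp [hx]
    exact fun a ha => this ha
  let ψ := Ideal.Quotient.liftₐ (edgeIdeal K Adj) φ hker
  have hψ : ∀ p, ψ (Ideal.Quotient.mk _ p) = φ p := fun p => rfl
  let D : ℕ := Finset.univ.sup fun i => degreeOf (b i) (ψ (w i))
  let E : σ →₀ ℕ := Finsupp.indicator F (fun _ _ => D + 1)
  let N : Submodule K (MvPolynomial σ K ⧸ edgeIdeal K Adj) :=
    LinearMap.ker ((lcoeff K E).comp ψ.toLinearMap)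
  have hle : (⨆ i, stanleySpace K σ (MvPolynomial σ K ⧸ edgeIdeal K Adj) (w i) (A i)) ≤ N := by
    refine iSup_le fun i => Submodule.span_le.mpr ?_
    rintro _ ⟨u, hu, rfl⟩
    have hsm : ψ ((monomial u (1 : K) : MvPolynomial σ K) • w i)
        = φ (monomial u (1 : K)) * ψ (w i) := by
      obtain ⟨p, hp⟩ := Ideal.Quotient.mk_surjective (w i)
      rw [← hp]
      change ψ (Ideal.Quotient.mk _ (monomial u (1 : K) * p)) = _
      rw [hψ, hψ, map_mul]
    change coeff E (ψ ((monomial u (1 : K) : MvPolynomial σ K) • w i)) = 0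
    rw [hsm, kill_monomial]
    split_ifs with h
    · rw [coeff_monomial_mul']
      split_ifs with h2
      · rw [one_mul]
        by_contra hne
        have h3 := monomial_le_degreeOf (b i) (mem_support_iff.mpr hne)
        have h4 : degreeOf (b i) (ψ (w i)) ≤ D :=
          Finset.le_sup (f := fun i => degreeOf (b i) (ψ (w i))) (Finset.mem_univ i)
        have h5 : u (b i) = 0 := by
          by_contra h6
          exact hbA i (hu (Finsupp.mem_support_iff.mpr h6))
        have h7 : E (b i) = D + 1 := by simp [E, hbF i]
        rw [Finsupp.tsub_apply, h5, h7] at h3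
        omega
      · rfl
    · simp
  rw [htop] at hle
  have hmem : Ideal.Quotient.mk (edgeIdeal K Adj) (monomial E (1 : K)) ∈ N := hle trivial
  have h1 : coeff E (φ (monomial E (1 : K))) = 0 := hmem
  rw [kill_monomial, if_pos (Finsupp.support_indicator_subset _ _)] at h1
  simp at h1

theorem sdepth_quotient_edgeIdeal_C_le (K : Type) [Field K] (n m : ℕ)
    (hn : 3 ≤ n) (hm : 1 ≤ m) :
    sdepth K (Fin n × Fin m)
        (MvPolynomial (Fin n × Fin m) K ⧸ edgeIdeal K (cAdj n m)) ≤
      ((n + 2) / 3) * ((m + 2) / 3) := by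
  let f : Fin ((n + 2) / 3) × Fin ((m + 2) / 3) → Fin n × Fin m := fun p =>
    (⟨min (3 * p.1.1) (n - 2), by omega⟩, ⟨min (3 * p.2.1 + 1) (m - 1), by omega⟩)
  have hF : (Finset.univ.image f).card ≤ ((n + 2) / 3) * ((m + 2) / 3) := by
    refine Finset.card_image_le.trans ?_
    simp
  refine (sdepth_le_card K (cAdj n m) (Finset.univ.image f) ?_ ?_).trans hF
  · intro a ha c hc
    simp only [Finset.mem_image, Finset.mem_univ, true_and] at ha hc
    obtain ⟨⟨⟨p, hp⟩, ⟨q, hq⟩⟩, rfl⟩ := ha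
    obtain ⟨⟨⟨p', hp'⟩, ⟨q', hq'⟩⟩, rfl⟩ := hc
    rintro ⟨hne, h1, h2⟩
    simp only [f, abs_le] at h1 h2
    apply hne
    have e1 : p = p' := by omega
    have e2 : q = q' := by omega
    subst e1 e2
    rfl
  · rintro ⟨⟨i, hi⟩, ⟨j, hj⟩⟩ hx
    have key : ∃ p, p < (n + 2) / 3 ∧
        min ((i : ℤ) - ((min (3 * p) (n - 2) : ℕ) : ℤ)).natAbs
          (n - ((i : ℤ) - ((min (3 * p) (n - 2) : ℕ) : ℤ)).natAbs) ≤ 1 := by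
      by_cases h : (i + 1) / 3 < (n + 2) / 3
      · exact ⟨(i + 1) / 3, h, by omega⟩
      · exact ⟨0, by omega, by omega⟩
    obtain ⟨p, hp, hp1⟩ := key
    have hmem : f (⟨p, hp⟩, ⟨j / 3, by omega⟩) ∈ Finset.univ.image f :=
      Finset.mem_image_of_mem _ (Finset.mem_univ _)
    refine ⟨_, hmem, ?_, ?_, ?_⟩
    · intro h
      exact hx (h ▸ hmem)
    · exact hp1
    · simp only [f, abs_le]
      omega
end
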